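/- Let d ≥ 2, p > 1, and 1 < μ ≤ d/p, and define q by 1/q = 1/p − 1/(μp) (so q > p). Then there is a constant N = N(d, p, μ) such that for every continuously differentiable function u : ℝ^d → ℝ with compact support, sup_{x ∈ ℝ^d, ρ > 0} ρ^{μp/q} (|B_ρ(x)|^{−1} ∫_{B_ρ(x)} |u(y)|^q dy)^{1/q} ≤ N · sup_{x ∈ ℝ^d, ρ > 0} ρ^μ (|B_ρ(x)|^{−1} ∫_{B_ρ(x)} |∇u(y)|^p dy)^{1/p}. -/

import Mathlib

open MeasureTheory Metric ENNReal

/-- The Morrey norm `‖g‖_{E_{p,μ}}` on the whole space `ℝ^d`: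
`sup_{x, ρ>0} ρ^μ (|B_ρ(x)|⁻¹ ∫_{B_ρ(x)} |g|^p)^{1/p}`, as a value in `ℝ≥0∞`. -/
noncomputable def morreyNormFull (d : ℕ) (p μ : ℝ)
    (g : EuclideanSpace ℝ (Fin d) → ℝ) : ℝ≥0∞ :=
  ⨆ (x : EuclideanSpace ℝ (Fin d)) (ρ : ℝ) (_ : 0 < ρ),
    ENNReal.ofReal (ρ ^ μ *
      ((volume (ball x ρ)).toReal⁻¹ * ∫ y in ball x ρ, |g y| ^ p) ^ (1 / p))

section MaximalFunction

open Module Set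

variable {E : Type*} [NormedAddCommGroup E] [NormedSpace ℝ E] [MeasurableSpace E]

/-- The average of `f` over `ball x t`, multiplied by the measure of the unit ball. -/
noncomputable def ballAvg (ν : Measure E) (f : E → ℝ≥0∞) (x : E) (t : ℝ) : ℝ≥0∞ :=
  ∫⁻ z in ball (0 : E) 1, f (x + t • z) ∂ν

/-- The centred dyadic Hardy-Littlewood maximal function, multiplied by the measure of the
unit ball. -/
noncomputable def dyadicMaximal (ν : Measure E) (f : E → ℝ≥0∞) (x : E) : ℝ≥0∞ :=
  ⨆ n : ℤ, ballAvg ν f x (2 ^ n)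

theorem dyadicMaximal_le_of_le (ν : Measure E) {f : E → ℝ≥0∞} {c : ℝ≥0∞} (h : ∀ x, f x ≤ c)
    (x : E) :
    dyadicMaximal ν f x ≤ c * ν (ball 0 1) :=
  iSup_le fun _ => (lintegral_mono fun _ => h _).trans (by simp)

theorem dyadicMaximal_le_add (ν : Measure E) {f g : E → ℝ≥0∞} {c : ℝ≥0∞}
    (h : ∀ x, f x ≤ g x + c) (x : E) :
    dyadicMaximal ν f x ≤ dyadicMaximal ν g x + c * ν (ball 0 1) := by
  refine iSup_le fun n => ?_
  calc ballAvg ν f x (2 ^ n) ≤ ∫⁻ z in ball (0 : E) 1, (g (x + (2 : ℝ) ^ n • z) + c) ∂ν :=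
        lintegral_mono fun _ => h _
    _ = ballAvg ν g x (2 ^ n) + c * ν (ball 0 1) := by
        rw [lintegral_add_right _ measurable_const]; simp [ballAvg]
    _ ≤ _ := by gcongr; exact le_iSup (fun n : ℤ => ballAvg ν g x (2 ^ n)) n

theorem dyadicMaximal_le_add_of_mem_ball [BorelSpace E] (ν : Measure E) {f : E → ℝ≥0∞} {c : ℝ≥0∞}
    {x₀ x : E} {r : ℝ} (hx : x ∈ ball x₀ r) (h : ∀ t, r < t → ballAvg ν f x t ≤ c) :
    dyadicMaximal ν f x ≤ dyadicMaximal ν ((ball x₀ (2 * r)).indicator f) x + c := by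
  refine iSup_le fun n => ?_
  rcases lt_or_ge r (2 ^ n) with hn | hn
  · exact (h _ hn).trans le_add_self
  · refine le_add_right (le_trans (le_of_eq ?_)
      (le_iSup (fun n : ℤ => ballAvg ν ((ball x₀ (2 * r)).indicator f) x (2 ^ n)) n))
    refine setLIntegral_congr_fun measurableSet_ball fun z hz => ?_
    have hpos : (0 : ℝ) < 2 ^ n := by positivity
    have hmem : x + (2 : ℝ) ^ n • z ∈ ball x₀ (2 * r) := by
      rw [mem_ball, dist_eq_norm] at hx ⊢
      have h1 : ‖(2 : ℝ) ^ n • z‖ < 2 ^ n := by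
        rw [norm_smul, Real.norm_of_nonneg hpos.le]
        exact mul_lt_of_lt_one_right hpos (mem_ball_zero_iff.1 hz)
      calc ‖x + (2 : ℝ) ^ n • z - x₀‖ = ‖(x - x₀) + (2 : ℝ) ^ n • z‖ := by congr 1; abel
        _ ≤ ‖x - x₀‖ + ‖(2 : ℝ) ^ n • z‖ := norm_add_le _ _
        _ < 2 * r := by linarith
    exact (indicator_of_mem hmem f).symm

variable [FiniteDimensional ℝ E] [BorelSpace E] (ν : Measure E) [ν.IsAddHaarMeasure]

theorem ofReal_pow_mul_ballAvg (f : E → ℝ≥0∞) (x : E) {t : ℝ} (ht : 0 < t) :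
    ENNReal.ofReal (t ^ finrank ℝ E) * ballAvg ν f x t = ∫⁻ y in ball x t, f y ∂ν := by
  have hemb : MeasurableEmbedding (fun z : E => t • z) :=
    (Homeomorph.smulOfNeZero t ht.ne').measurableEmbedding
  have hind : ∀ z : E, (ball x t).indicator f (x + t • z) =
      (ball (0 : E) 1).indicator (fun z => f (x + t • z)) z := by
    intro z
    have : x + t • z ∈ ball x t ↔ z ∈ ball (0 : E) 1 := by
      simp [norm_smul, abs_of_pos ht, ht]
    by_cases hz : z ∈ ball (0 : E) 1
    · rw [indicator_of_mem hz, indicator_of_mem (this.2 hz)]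
    · rw [indicator_of_notMem hz, indicator_of_notMem (fun h => hz (this.1 h))]
  have hpos : 0 < t ^ finrank ℝ E := pow_pos ht _
  have key : ballAvg ν f x t =
      ENNReal.ofReal (t ^ finrank ℝ E)⁻¹ * ∫⁻ y in ball x t, f y ∂ν := by
    rw [ballAvg, ← lintegral_indicator measurableSet_ball, ← lintegral_indicator measurableSet_ball,
      ← lintegral_add_left_eq_self ((ball x t).indicator f) x]
    simp_rw [← hind]
    rw [← hemb.lintegral_map (fun y => (ball x t).indicator f (x + y)),
      Measure.map_addHaar_smul ν ht.ne', lintegral_smul_measure, abs_of_pos (inv_pos.2 hpos)]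
    rfl
  rw [key, ← mul_assoc, ← ENNReal.ofReal_mul hpos.le, mul_inv_cancel₀ hpos.ne']
  simp

theorem measurable_ballAvg {f : E → ℝ≥0∞} (hf : Measurable f) :
    Measurable fun w : E × ℝ => ballAvg ν f w.1 w.2 := by
  have h : Measurable fun w : (E × ℝ) × E => f (w.1.1 + w.1.2 • w.2) := hf.comp (by fun_prop)
  exact h.lintegral_prod_right' (ν := ν.restrict (ball 0 1))

theorem measurable_dyadicMaximal {f : E → ℝ≥0∞} (hf : Measurable f) :
    Measurable (dyadicMaximal ν f) :=
  Measurable.iSup fun _ => (measurable_ballAvg ν hf).comp (measurable_id.prodMk measurable_const)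

theorem ballAvg_le_dyadicMaximal (f : E → ℝ≥0∞) (x : E) {t : ℝ} (ht : 0 < t) :
    ballAvg ν f x t ≤ 2 ^ finrank ℝ E * dyadicMaximal ν f x := by
  obtain ⟨n, hn1, hn2⟩ := exists_mem_Ioc_zpow ht (one_lt_two (α := ℝ))
  have hpos : 0 < t ^ finrank ℝ E := pow_pos ht _
  have h2 : (0 : ℝ) < 2 ^ (n + 1) := by positivity
  have h3 : (2 : ℝ) ^ (n + 1) ≤ 2 * t := by
    rw [zpow_add_one₀ two_ne_zero]; linarith
  rw [← ENNReal.mul_le_mul_iff_right (a := ENNReal.ofReal (t ^ finrank ℝ E))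
    (by simpa using hpos) ofReal_ne_top, ofReal_pow_mul_ballAvg ν f x ht]
  calc ∫⁻ y in ball x t, f y ∂ν ≤ ∫⁻ y in ball x (2 ^ (n + 1)), f y ∂ν :=
        lintegral_mono_set (ball_subset_ball hn2)
    _ = ENNReal.ofReal ((2 ^ (n + 1)) ^ finrank ℝ E) * ballAvg ν f x (2 ^ (n + 1)) :=
        (ofReal_pow_mul_ballAvg ν f x h2).symm
    _ ≤ ENNReal.ofReal ((2 * t) ^ finrank ℝ E) * dyadicMaximal ν f x := by
        gcongr
        exact le_iSup (fun n : ℤ => ballAvg ν f x (2 ^ n)) (n + 1)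
    _ = _ := by
        rw [mul_pow, ENNReal.ofReal_mul (by positivity), ENNReal.ofReal_pow zero_le_two]
        simp only [ENNReal.ofReal_ofNat]
        ring

theorem mul_measure_lt_dyadicMaximal_le [Nontrivial E] (f : E → ℝ≥0∞)
    (s : ℝ≥0∞) :
    s * ν {x | s < dyadicMaximal ν f x} ≤
      5 ^ finrank ℝ E * ν (ball 0 1) * ∫⁻ y, f y ∂ν := by
  rcases eq_or_ne s 0 with rfl | hs0
  · simp
  have hV : ν (ball (0 : E) 1) ≠ 0 := (measure_ball_pos ν _ one_pos).ne'
  rcases eq_or_ne (∫⁻ y, f y ∂ν) ⊤ with hI | hI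
  · rw [hI, mul_top (by simp [hV])]
    exact le_top
  rcases eq_or_ne s ⊤ with rfl | hst
  · simp
  set D := finrank ℝ E with hD
  have hDpos : D ≠ 0 := (finrank_pos (R := ℝ) (M := E)).ne'
  have hex : ∀ x ∈ {x | s < dyadicMaximal ν f x}, ∃ r : ℝ, 0 < r ∧ s < ballAvg ν f x r := by
    intro x hx
    obtain ⟨n, hn⟩ := lt_iSup_iff.1 (show s < ⨆ n : ℤ, ballAvg ν f x (2 ^ n) from hx)
    exact ⟨2 ^ n, by positivity, hn⟩
  choose! r hr0 hr using hex
  have hint : ∀ x ∈ {x | s < dyadicMaximal ν f x},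
      s * ENNReal.ofReal (r x ^ D) ≤ ∫⁻ y in closedBall x (r x), f y ∂ν := by
    intro x hx
    calc s * ENNReal.ofReal (r x ^ D) ≤ ENNReal.ofReal (r x ^ D) * ballAvg ν f x (r x) := by
          rw [mul_comm]; gcongr; exact (hr x hx).le
      _ = ∫⁻ y in ball x (r x), f y ∂ν := ofReal_pow_mul_ballAvg ν f x (hr0 x hx)
      _ ≤ _ := lintegral_mono_set ball_subset_closedBall
  have hbdd : ∀ x ∈ {x | s < dyadicMaximal ν f x},
      r x ≤ max 1 ((∫⁻ y, f y ∂ν) / s).toReal := by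
    intro x hx
    rcases le_total (r x) 1 with h1 | h1
    · exact h1.trans (le_max_left _ _)
    refine le_trans ?_ (le_max_right _ _)
    refine (le_self_pow₀ h1 hDpos).trans ?_
    rw [← ENNReal.ofReal_le_iff_le_toReal (ENNReal.div_ne_top hI hs0),
      ENNReal.le_div_iff_mul_le (Or.inl hs0) (Or.inl hst), mul_comm]
    exact (hint x hx).trans (setLIntegral_le_lintegral _ _)
  obtain ⟨u, hut, hdisj, hcov⟩ := Vitali.exists_disjoint_subfamily_covering_enlargement_closedBall
    {x | s < dyadicMaximal ν f x} id r _ hbdd 5 (by norm_num)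
  have hcount : u.Countable := hdisj.countable_of_nonempty_interior fun x hx =>
    (nonempty_ball.2 (hr0 x (hut hx))).mono ball_subset_interior_closedBall
  have hsub : {x | s < dyadicMaximal ν f x} ⊆ ⋃ x ∈ u, closedBall x (5 * r x) := by
    intro x hx
    obtain ⟨b, hb, hxb⟩ := hcov x hx
    exact mem_biUnion hb (hxb (mem_closedBall_self (hr0 x hx).le))
  have := hcount.to_subtype
  calc s * ν {x | s < dyadicMaximal ν f x}
      ≤ s * ∑' x : u, ν (closedBall (x : E) (5 * r x)) := by
        gcongr
        exact (measure_mono hsub).trans (measure_biUnion_le ν hcount _)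
    _ = ∑' x : u, 5 ^ D * ν (ball 0 1) * (s * ENNReal.ofReal (r x ^ D)) := by
        rw [← ENNReal.tsum_mul_left]
        congr 1 with x
        rw [Measure.addHaar_closedBall ν _ (by linarith [hr0 x (hut x.2)]), mul_pow,
          ENNReal.ofReal_mul (by positivity), ENNReal.ofReal_pow (by norm_num), ← hD]
        simp only [ENNReal.ofReal_ofNat]
        ring
    _ ≤ ∑' x : u, 5 ^ D * ν (ball 0 1) * ∫⁻ y in closedBall (x : E) (r x), f y ∂ν := by
        gcongr with x
        exact hint x (hut x.2)
    _ = 5 ^ D * ν (ball 0 1) * ∫⁻ y in ⋃ x ∈ u, closedBall x (r x), f y ∂ν := by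
        rw [ENNReal.tsum_mul_left]
        exact congrArg _
          (lintegral_biUnion hcount (fun _ _ => measurableSet_closedBall) hdisj f).symm
    _ ≤ _ := by gcongr; exact Measure.restrict_le_self

theorem setLIntegral_Ioi_indicator_rpow {p : ℝ} (hp : 0 < p) {a : ℝ≥0∞} (ha : a ≠ ⊤) :
    ∫⁻ t in Ioi (0 : ℝ), {t : ℝ | ENNReal.ofReal t < a}.indicator
      (fun t => ENNReal.ofReal (p * t ^ (p - 1))) t = a ^ p := by
  lift a to NNReal using ha
  have hset : {t : ℝ | ENNReal.ofReal t < a} ∩ Ioi 0 = Ioo 0 (a : ℝ) := by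
    ext t
    simp only [mem_inter_iff, mem_ofPred_eq, mem_Ioi, mem_Ioo]
    constructor
    · rintro ⟨h1, h2⟩
      exact ⟨h2, by simpa [ENNReal.ofReal, h2.le, Real.toNNReal_lt_iff_lt_coe] using h1⟩
    · rintro ⟨h1, h2⟩
      exact ⟨by simpa [ENNReal.ofReal, h1.le, Real.toNNReal_lt_iff_lt_coe] using h2, h1⟩
  have hmeas : MeasurableSet {t : ℝ | ENNReal.ofReal t < a} :=
    measurableSet_lt ENNReal.measurable_ofReal measurable_const
  have hint : IntervalIntegrable (fun t : ℝ => p * t ^ (p - 1)) volume 0 a :=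
    (intervalIntegral.intervalIntegrable_rpow' (by linarith)).const_mul p
  rw [setLIntegral_indicator hmeas, hset, setLIntegral_congr Ioo_ae_eq_Ioc,
    ← ofReal_integral_eq_lintegral_ofReal,
    ← intervalIntegral.integral_of_le a.coe_nonneg, intervalIntegral.integral_const_mul,
    integral_rpow (Or.inl (by linarith))]
  · rw [sub_add_cancel, Real.zero_rpow hp.ne', sub_zero, mul_div_cancel₀ _ hp.ne',
      ← ENNReal.ofReal_rpow_of_nonneg a.coe_nonneg hp.le, ENNReal.ofReal_coe_nnreal]
  · exact (intervalIntegrable_iff_integrableOn_Ioc_of_le a.2).1 hint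
  · filter_upwards [ae_restrict_mem measurableSet_Ioc] with t ht
    have := ht.1.le
    positivity

/-- The weak-type bound for the maximal function, localised to the level set of `f`. -/
theorem mul_measure_lt_dyadicMaximal_le_indicator [Nontrivial E] (f : E → ℝ≥0∞) (s : ℝ≥0∞) :
    s * ν {x | s < dyadicMaximal ν f x} ≤ 2 * 5 ^ finrank ℝ E * ν (ball 0 1) *
      ∫⁻ y, {y | s < 2 * ν (ball 0 1) * f y}.indicator f y ∂ν := by
  set V := ν (ball (0 : E) 1) with hVdef
  have hV0 : V ≠ 0 := (measure_ball_pos ν _ one_pos).ne'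
  have hVt : V ≠ ⊤ := measure_ball_lt_top.ne
  set g := {y | s < 2 * V * f y}.indicator f with hg
  have h2V : 2 * V ≠ 0 := mul_ne_zero two_ne_zero hV0
  have h2Vt : 2 * V ≠ ⊤ := mul_ne_top ofNat_ne_top hVt
  have hfg : ∀ x, f x ≤ g x + s / (2 * V) := by
    intro x
    by_cases hx : s < 2 * V * f x
    · rw [hg, indicator_of_mem (by exact hx)]
      exact le_self_add
    · refine le_add_left ?_
      rw [ENNReal.le_div_iff_mul_le (Or.inl h2V) (Or.inl h2Vt), mul_comm]
      exact not_lt.1 hx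
  have hM : ∀ x, dyadicMaximal ν f x ≤ dyadicMaximal ν g x + s / 2 := by
    intro x
    refine (dyadicMaximal_le_add ν hfg x).trans (le_of_eq ?_)
    rw [← hVdef, ENNReal.div_eq_inv_mul, ENNReal.div_eq_inv_mul,
      ENNReal.mul_inv (Or.inl two_ne_zero) (Or.inl ofNat_ne_top)]
    congr 1
    calc 2⁻¹ * V⁻¹ * s * V = 2⁻¹ * s * (V⁻¹ * V) := by ring
      _ = _ := by rw [ENNReal.inv_mul_cancel hV0 hVt, mul_one]
  have hsub : {x | s < dyadicMaximal ν f x} ⊆ {x | s / 2 < dyadicMaximal ν g x} := by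
    intro x hx
    by_contra hcon
    have h1 : dyadicMaximal ν f x ≤ s / 2 + s / 2 :=
      (hM x).trans (by gcongr; exact not_lt.1 hcon)
    rw [ENNReal.add_halves] at h1
    exact absurd hx (not_lt.2 h1)
  calc s * ν {x | s < dyadicMaximal ν f x}
      ≤ (2 * (s / 2)) * ν {x | s / 2 < dyadicMaximal ν g x} := by
        rw [ENNReal.mul_div_cancel two_ne_zero ofNat_ne_top]
        gcongr
    _ = 2 * (s / 2 * ν {x | s / 2 < dyadicMaximal ν g x}) := by ring
    _ ≤ 2 * (5 ^ finrank ℝ E * V * ∫⁻ y, g y ∂ν) := by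
        exact mul_le_mul' le_rfl (mul_measure_lt_dyadicMaximal_le ν g _)
    _ = _ := by ring

/-- The **Hardy-Littlewood maximal inequality** for bounded functions. -/
theorem exists_lintegral_dyadicMaximal_rpow_le [Nontrivial E] {p : ℝ} (hp : 1 < p) :
    ∃ C : ℝ≥0∞, C ≠ ⊤ ∧ ∀ f : E → ℝ≥0∞, Measurable f → ∀ K : ℝ≥0∞, K ≠ ⊤ → (∀ x, f x ≤ K) →
      ∫⁻ x, dyadicMaximal ν f x ^ p ∂ν ≤ C * ∫⁻ x, f x ^ p ∂ν := by
  set V := ν (ball (0 : E) 1) with hVdef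
  have hVt : V ≠ ⊤ := measure_ball_lt_top.ne
  have h2Vt : 2 * V ≠ ⊤ := mul_ne_top ofNat_ne_top hVt
  set A : ℝ≥0∞ := 2 * 5 ^ finrank ℝ E * V with hA
  have hAt : A ≠ ⊤ := by finiteness
  have hp0 : 0 < p := by linarith
  have hp1 : 0 < p - 1 := by linarith
  refine ⟨A * ENNReal.ofReal (p / (p - 1)) * (2 * V) ^ (p - 1), by finiteness, ?_⟩
  intro f hf K hK hfK
  have hMt : ∀ x, dyadicMaximal ν f x ≠ ⊤ := fun x =>
    ne_top_of_le_ne_top (mul_ne_top hK hVt) (dyadicMaximal_le_of_le ν hfK x)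
  have hft : ∀ x, 2 * V * f x ≠ ⊤ := fun x =>
    mul_ne_top h2Vt (ne_top_of_le_ne_top hK (hfK x))
  have hswap : ∀ (F : E → ℝ≥0∞) (G : E → ℝ≥0∞) (r : ℝ), Measurable F → Measurable G →
      ∫⁻ x, (∫⁻ s in Ioi (0 : ℝ), G x * {s : ℝ | ENNReal.ofReal s < F x}.indicator
        (fun s => ENNReal.ofReal (r * s ^ (r - 1))) s) ∂ν =
      ∫⁻ s in Ioi (0 : ℝ), ∫⁻ x, G x * {s : ℝ | ENNReal.ofReal s < F x}.indicator
        (fun s => ENNReal.ofReal (r * s ^ (r - 1))) s ∂ν := by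
    intro F G r hF hG
    refine lintegral_lintegral_swap (Measurable.aemeasurable ?_)
    have hset : MeasurableSet {w : E × ℝ | ENNReal.ofReal w.2 < F w.1} :=
      measurableSet_lt (ENNReal.measurable_ofReal.comp measurable_snd) (hF.comp measurable_fst)
    have hm : Measurable fun w : E × ℝ => ENNReal.ofReal (r * w.2 ^ (r - 1)) := by fun_prop
    exact (hG.comp measurable_fst).mul (hm.indicator hset)
  have hlevel : ∀ s ∈ Ioi (0 : ℝ),
      ∫⁻ x, 1 * {s : ℝ | ENNReal.ofReal s < dyadicMaximal ν f x}.indicator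
        (fun s => ENNReal.ofReal (p * s ^ (p - 1))) s ∂ν ≤
      A * ENNReal.ofReal (p / (p - 1)) *
        ∫⁻ x, f x * {s : ℝ | ENNReal.ofReal s < 2 * V * f x}.indicator
          (fun s => ENNReal.ofReal ((p - 1) * s ^ (p - 1 - 1))) s ∂ν := by
    intro s hs
    have hs : 0 < s := hs
    have hpow : s ^ (p - 1) = s * s ^ (p - 1 - 1) := by
      rw [Real.rpow_sub_one hs.ne' (p - 1)]; field_simp
    have hcoef : ENNReal.ofReal (p * s ^ (p - 1)) = ENNReal.ofReal (p / (p - 1)) *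
        ENNReal.ofReal ((p - 1) * s ^ (p - 1 - 1)) * ENNReal.ofReal s := by
      rw [← ENNReal.ofReal_mul (by positivity), ← ENNReal.ofReal_mul (by positivity), hpow]
      congr 1
      field_simp
    have hl : ∫⁻ x, 1 * {s : ℝ | ENNReal.ofReal s < dyadicMaximal ν f x}.indicator
        (fun s => ENNReal.ofReal (p * s ^ (p - 1))) s ∂ν =
        ENNReal.ofReal (p * s ^ (p - 1)) * ν {x | ENNReal.ofReal s < dyadicMaximal ν f x} := by
      rw [← lintegral_indicator_const
        (measurableSet_lt measurable_const (measurable_dyadicMaximal ν hf))]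
      simp only [one_mul]
      rfl
    have hr : ∫⁻ x, f x * {s : ℝ | ENNReal.ofReal s < 2 * V * f x}.indicator
          (fun s => ENNReal.ofReal ((p - 1) * s ^ (p - 1 - 1))) s ∂ν =
        ENNReal.ofReal ((p - 1) * s ^ (p - 1 - 1)) *
          ∫⁻ x, {x | ENNReal.ofReal s < 2 * V * f x}.indicator f x ∂ν := by
      rw [← lintegral_const_mul _ (hf.indicator
        (measurableSet_lt measurable_const (hf.const_mul _)))]
      congr 1 with x
      by_cases hx : ENNReal.ofReal s < 2 * V * f x <;> simp [indicator, mul_comm]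
    rw [hl, hr, hcoef]
    calc _ = ENNReal.ofReal (p / (p - 1)) * ENNReal.ofReal ((p - 1) * s ^ (p - 1 - 1)) *
          (ENNReal.ofReal s * ν {x | ENNReal.ofReal s < dyadicMaximal ν f x}) := by ring
      _ ≤ ENNReal.ofReal (p / (p - 1)) * ENNReal.ofReal ((p - 1) * s ^ (p - 1 - 1)) *
          (A * ∫⁻ x, {x | ENNReal.ofReal s < 2 * V * f x}.indicator f x ∂ν) := by
          exact mul_le_mul' le_rfl (mul_measure_lt_dyadicMaximal_le_indicator ν f _)
      _ = _ := by ring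
  calc ∫⁻ x, dyadicMaximal ν f x ^ p ∂ν
      = ∫⁻ x, (∫⁻ s in Ioi (0 : ℝ), 1 * {s : ℝ | ENNReal.ofReal s < dyadicMaximal ν f x}.indicator
        (fun s => ENNReal.ofReal (p * s ^ (p - 1))) s) ∂ν := by
        simp_rw [one_mul, setLIntegral_Ioi_indicator_rpow hp0 (hMt _)]
    _ = ∫⁻ s in Ioi (0 : ℝ), ∫⁻ x, 1 * {s : ℝ | ENNReal.ofReal s <
          dyadicMaximal ν f x}.indicator (fun s => ENNReal.ofReal (p * s ^ (p - 1))) s ∂ν :=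
        hswap _ (fun _ => 1) _ (measurable_dyadicMaximal ν hf) measurable_const
    _ ≤ ∫⁻ s in Ioi (0 : ℝ), A * ENNReal.ofReal (p / (p - 1)) *
        ∫⁻ x, f x * {s : ℝ | ENNReal.ofReal s < 2 * V * f x}.indicator
          (fun s => ENNReal.ofReal ((p - 1) * s ^ (p - 1 - 1))) s ∂ν :=
        setLIntegral_mono' measurableSet_Ioi hlevel
    _ = A * ENNReal.ofReal (p / (p - 1)) * ∫⁻ x, f x * (2 * V * f x) ^ (p - 1) ∂ν := by
        rw [lintegral_const_mul' _ _ (by finiteness), ← hswap _ _ _ (hf.const_mul _) hf]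
        simp_rw [lintegral_const_mul' _ _ (ne_top_of_le_ne_top hK (hfK _)),
          setLIntegral_Ioi_indicator_rpow hp1 (hft _)]
    _ = A * ENNReal.ofReal (p / (p - 1)) * ∫⁻ x, (2 * V) ^ (p - 1) * f x ^ p ∂ν := by
        congr 2 with x
        rw [ENNReal.mul_rpow_of_nonneg _ _ hp1.le, mul_left_comm]
        congr 1
        conv_rhs => rw [← add_sub_cancel 1 p, ENNReal.rpow_add_of_nonneg _ _ zero_le_one hp1.le,
          ENNReal.rpow_one]
    _ = _ := by
        rw [lintegral_const_mul' _ _ (by finiteness), mul_assoc _ ((2 * V) ^ (p - 1))]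

theorem enorm_mul_measure_ball_le_lintegral_ballAvg [Nontrivial E] {u : E → ℝ}
    (hu : ContDiff ℝ 1 u) (hc : HasCompactSupport u) (x : E) :
    ‖u x‖ₑ * ν (ball 0 1) ≤
      ∫⁻ t in Ioi (0 : ℝ), ballAvg ν (fun y => ‖fderiv ℝ u y‖ₑ) x t := by
  set f : E → ℝ≥0∞ := fun y => ‖fderiv ℝ u y‖ₑ with hf
  have hfm : Measurable f := (hu.continuous_fderiv one_ne_zero).enorm.measurable
  have hray : ∀ z ∈ ball (0 : E) 1, z ≠ 0 → ‖u x‖ₑ ≤ ∫⁻ t in Ioi (0 : ℝ), f (x + t • z) := by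
    intro z hz hz0
    have hline : ContDiff ℝ 1 fun t : ℝ => x + (-t) • z := by fun_prop
    have hemb : Topology.IsClosedEmbedding fun t : ℝ => x + (-t) • z :=
      (Homeomorph.addLeft x).isClosedEmbedding.comp
        ((isClosedEmbedding_smul_left hz0).comp (Homeomorph.neg ℝ).isClosedEmbedding)
    have hle := HasCompactSupport.enorm_le_lintegral_Ici_deriv (hu.comp hline)
      (hc.comp_isClosedEmbedding hemb) 0
    have hderiv : ∀ t, ‖deriv (u ∘ fun t : ℝ => x + (-t) • z) t‖ₑ ≤ f (x + (-t) • z) := by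
      intro t
      have h1 : HasDerivAt (fun t : ℝ => x + (-t) • z) (-z) t := by
        simpa using ((hasDerivAt_neg t).smul_const z).const_add x
      have h2 := ((hu.differentiable one_ne_zero) (x + (-t) • z)).hasFDerivAt.comp_hasDerivAt t h1
      rw [h2.deriv]
      refine (ContinuousLinearMap.le_opENorm _ _).trans ?_
      have hz1 : ‖-z‖ₑ ≤ 1 := by
        rw [enorm_neg, ← ofReal_norm]
        exact ENNReal.ofReal_le_one.2 (mem_ball_zero_iff.1 hz).le
      exact (mul_le_mul' le_rfl hz1).trans (by rw [mul_one])
    calc ‖u x‖ₑ ≤ ∫⁻ t in Iic (0 : ℝ), ‖deriv (u ∘ fun t : ℝ => x + (-t) • z) t‖ₑ := by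
          simpa using hle
      _ ≤ ∫⁻ t in Iic (0 : ℝ), f (x + (-t) • z) := lintegral_mono hderiv
      _ = ∫⁻ t in Ici (0 : ℝ), f (x + t • z) := by
          have := (Measure.measurePreserving_neg (volume : Measure ℝ)).setLIntegral_comp_preimage_emb
            (Homeomorph.neg ℝ).measurableEmbedding (fun t => f (x + t • z)) (Ici 0)
          rw [← this]
          congr 2
          ext t
          simp
      _ = ∫⁻ t in Ioi (0 : ℝ), f (x + t • z) := setLIntegral_congr Ioi_ae_eq_Ici.symm
  calc ‖u x‖ₑ * ν (ball 0 1) = ∫⁻ _ in ball (0 : E) 1, ‖u x‖ₑ ∂ν := by simp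
    _ ≤ ∫⁻ z in ball (0 : E) 1, (∫⁻ t in Ioi (0 : ℝ), f (x + t • z)) ∂ν := by
        refine lintegral_mono_ae ?_
        filter_upwards [ae_restrict_mem measurableSet_ball,
          ae_restrict_of_ae (Measure.ae_ne ν (0 : E))] with z hz hz0
        exact hray z hz hz0
    _ = _ := by
        refine lintegral_lintegral_swap (Measurable.aemeasurable ?_)
        exact hfm.comp (by fun_prop)

theorem lintegral_Ioi_ballAvg_le {f : E → ℝ≥0∞} {K m : ℝ} (hK : 0 ≤ K) (hm : 1 < m) (x : E)
    (h : ∀ t, 0 < t → ballAvg ν f x t ≤ ENNReal.ofReal (K * t ^ (-m))) {r : ℝ} (hr : 0 < r) :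
    ∫⁻ t in Ioi (0 : ℝ), ballAvg ν f x t ≤
      ENNReal.ofReal r * (2 ^ finrank ℝ E * dyadicMaximal ν f x) +
        ENNReal.ofReal (K * (r ^ (1 - m) / (m - 1))) := by
  rw [← Ioc_union_Ioi_eq_Ioi hr.le]
  refine (lintegral_union_le _ _ _).trans (add_le_add ?_ ?_)
  · calc ∫⁻ t in Ioc 0 r, ballAvg ν f x t
        ≤ ∫⁻ _ in Ioc 0 r, 2 ^ finrank ℝ E * dyadicMaximal ν f x :=
          setLIntegral_mono' measurableSet_Ioc fun t ht => ballAvg_le_dyadicMaximal ν f x ht.1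
      _ = _ := by simp [mul_comm]
  · calc ∫⁻ t in Ioi r, ballAvg ν f x t ≤ ∫⁻ t in Ioi r, ENNReal.ofReal (K * t ^ (-m)) :=
          setLIntegral_mono' measurableSet_Ioi fun t ht => h t (hr.trans ht)
      _ = ENNReal.ofReal (∫ t in Ioi r, K * t ^ (-m)) := by
          refine (ofReal_integral_eq_lintegral_ofReal
            ((integrableOn_Ioi_rpow_of_lt (by linarith) hr).const_mul K) ?_).symm
          filter_upwards [ae_restrict_mem measurableSet_Ioi] with t ht
          have : 0 < t := hr.trans ht
          positivity
      _ = _ := by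
          rw [integral_const_mul, integral_Ioi_rpow_of_lt (by linarith) hr,
            show -m + 1 = -(m - 1) by ring, neg_div_neg_eq, show -(m - 1) = 1 - m by ring]

theorem le_mul_rpow_of_forall_le {w B K m : ℝ} (hB : 0 ≤ B) (hK : 0 < K) (hm : 1 < m)
    (h : ∀ r : ℝ, 0 < r → w ≤ r * B + K * (r ^ (1 - m) / (m - 1))) :
    w ≤ m / (m - 1) * K ^ (1 / m) * B ^ (1 - 1 / m) := by
  have hm1 : 0 < m - 1 := by linarith
  have hm0 : 0 < m := by linarith
  have he : 0 < 1 - 1 / m := by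
    rw [sub_pos, div_lt_one hm0]; exact hm
  rcases hB.eq_or_lt with rfl | hB
  · rw [Real.zero_rpow he.ne', mul_zero]
    have hlim : Filter.Tendsto (fun r : ℝ => K * (r ^ (1 - m) / (m - 1))) Filter.atTop
        (nhds 0) := by
      have := ((tendsto_rpow_neg_atTop hm1).div_const (m - 1)).const_mul K
      simpa using this
    refine ge_of_tendsto hlim ?_
    filter_upwards [Filter.eventually_gt_atTop 0] with r hr
    simpa using h r hr
  · have hr : 0 < (K / B) ^ (1 / m) := by positivity
    refine (h _ hr).trans (le_of_eq ?_)
    have h1 : (K / B) ^ (1 / m) * B = K ^ (1 / m) * B ^ (1 - 1 / m) := by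
      rw [Real.div_rpow hK.le hB.le, Real.rpow_sub hB, Real.rpow_one]
      ring
    have h2 : K * ((K / B) ^ (1 / m)) ^ (1 - m) = K ^ (1 / m) * B ^ (1 - 1 / m) := by
      rw [← Real.rpow_mul (by positivity), show 1 / m * (1 - m) = 1 / m - 1 by field_simp,
        Real.div_rpow hK.le hB.le, Real.rpow_sub hK, Real.rpow_one,
        show 1 / m - 1 = -(1 - 1 / m) by ring, Real.rpow_neg hB.le]
      field_simp
    rw [← mul_div_assoc, h2, h1]
    field_simp
    ring

theorem ballAvg_le_of_lintegral_rpow_le {p : ℝ} (hp : 1 < p) {f : E → ℝ≥0∞} (hf : Measurable f)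
    {x : E} {t : ℝ} (ht : 0 < t) {c : ℝ≥0∞}
    (h : ∫⁻ y in ball x t, f y ^ p ∂ν ≤ c ^ p * ν (ball x t)) :
    ballAvg ν f x t ≤ c * ν (ball 0 1) := by
  have hpq := Real.HolderConjugate.conjExponent hp
  set p' := p.conjExponent
  have hp0 : 0 < p := hpq.pos
  have hB0 : ν (ball x t) ≠ 0 := (measure_ball_pos ν _ ht).ne'
  have hBt : ν (ball x t) ≠ ⊤ := measure_ball_lt_top.ne
  have hpos : 0 < t ^ finrank ℝ E := pow_pos ht _
  have hH : ∫⁻ y in ball x t, f y ∂ν ≤ c * ν (ball x t) := by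
    calc ∫⁻ y in ball x t, f y ∂ν = ∫⁻ y in ball x t, (f * (fun _ => 1 : E → ℝ≥0∞)) y ∂ν := by simp
      _ ≤ (∫⁻ y in ball x t, f y ^ p ∂ν) ^ (1 / p) *
          (∫⁻ _ in ball x t, (1 : ℝ≥0∞) ^ p' ∂ν) ^ (1 / p') :=
          ENNReal.lintegral_mul_le_Lp_mul_Lq _ hpq hf.aemeasurable measurable_const.aemeasurable
      _ ≤ (c ^ p * ν (ball x t)) ^ (1 / p) * ν (ball x t) ^ (1 / p') := by
          have hp'0 : 0 ≤ 1 / p' := one_div_nonneg.2 hpq.symm.nonneg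
          gcongr
          simp
      _ = c * ν (ball x t) := by
          rw [ENNReal.mul_rpow_of_nonneg _ _ (by positivity), ← ENNReal.rpow_mul,
            mul_one_div_cancel hp0.ne', ENNReal.rpow_one, mul_assoc,
            ← ENNReal.rpow_add _ _ hB0 hBt, one_div, one_div, hpq.inv_add_inv_eq_one,
            ENNReal.rpow_one]
  rw [← ENNReal.mul_le_mul_iff_right (a := ENNReal.ofReal (t ^ finrank ℝ E))
    (by simpa using hpos) ofReal_ne_top, ofReal_pow_mul_ballAvg ν f x ht]
  refine hH.trans (le_of_eq ?_)
  rw [← mul_one t, Measure.addHaar_ball_mul_of_pos ν x ht, mul_one]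
  ring

theorem exists_enorm_le_dyadicMaximal_rpow [Nontrivial E] {m : ℝ} (hm : 1 < m) :
    ∃ C : ℝ≥0∞, C ≠ ⊤ ∧ ∀ u : E → ℝ, ContDiff ℝ 1 u → HasCompactSupport u → ∀ K : ℝ, 0 < K →
      ∀ x, (∀ t, 0 < t → ballAvg ν (fun y => ‖fderiv ℝ u y‖ₑ) x t ≤
        ENNReal.ofReal (K * t ^ (-m)) * ν (ball 0 1)) →
      dyadicMaximal ν (fun y => ‖fderiv ℝ u y‖ₑ) x ≠ ⊤ →
      ‖u x‖ₑ ≤ C * ENNReal.ofReal K ^ (1 / m) *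
        dyadicMaximal ν (fun y => ‖fderiv ℝ u y‖ₑ) x ^ (1 - 1 / m) := by
  have hV0 : ν (ball (0 : E) 1) ≠ 0 := (measure_ball_pos ν _ one_pos).ne'
  have hVt : ν (ball (0 : E) 1) ≠ ⊤ := measure_ball_lt_top.ne
  obtain ⟨V, hV⟩ : ∃ V : ℝ, V = (ν (ball (0 : E) 1)).toReal := ⟨_, rfl⟩
  have hVof : ν (ball (0 : E) 1) = ENNReal.ofReal V := by rw [hV, ENNReal.ofReal_toReal hVt]
  have hVpos : 0 < V := hV ▸ ENNReal.toReal_pos hV0 hVt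
  have hm1 : 0 < m - 1 := by linarith
  have hm0 : 0 < m := by linarith
  have he : 0 < 1 - 1 / m := by
    rw [sub_pos, div_lt_one hm0]; exact hm
  refine ⟨ENNReal.ofReal (m / (m - 1) * V ^ (1 / m) *
    (2 ^ finrank ℝ E : ℝ) ^ (1 - 1 / m) / V), ofReal_ne_top, ?_⟩
  intro u hu hc K hK x hav hMt
  set f : E → ℝ≥0∞ := fun y => ‖fderiv ℝ u y‖ₑ
  obtain ⟨M, hM⟩ : ∃ M : ℝ, M = (dyadicMaximal ν f x).toReal := ⟨_, rfl⟩
  have hMof : dyadicMaximal ν f x = ENNReal.ofReal M := by rw [hM, ENNReal.ofReal_toReal hMt]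
  have hM0 : 0 ≤ M := hM ▸ ENNReal.toReal_nonneg
  have hav' : ∀ t, 0 < t → ballAvg ν f x t ≤ ENNReal.ofReal (K * V * t ^ (-m)) := by
    intro t ht
    refine (hav t ht).trans (le_of_eq ?_)
    rw [hVof, ← ENNReal.ofReal_mul (by positivity)]
    congr 1
    ring
  have hreal : ∀ r : ℝ, 0 < r → |u x| * V ≤
      r * (2 ^ finrank ℝ E * M) + K * V * (r ^ (1 - m) / (m - 1)) := by
    intro r hr
    have h1 := (enorm_mul_measure_ball_le_lintegral_ballAvg ν hu hc x).trans
      (lintegral_Ioi_ballAvg_le ν (by positivity) hm x hav' hr)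
    have h2 : (2 : ℝ≥0∞) ^ finrank ℝ E = ENNReal.ofReal (2 ^ finrank ℝ E) := by
      rw [ENNReal.ofReal_pow zero_le_two]; simp
    rw [hMof, hVof, h2, Real.enorm_eq_ofReal_abs, ← ENNReal.ofReal_mul (by positivity),
      ← ENNReal.ofReal_mul (by positivity), ← ENNReal.ofReal_mul (by positivity),
      ← ENNReal.ofReal_add (by positivity) (by positivity)] at h1
    exact (ENNReal.ofReal_le_ofReal_iff (by positivity)).1 h1
  have hfin := le_mul_rpow_of_forall_le (by positivity) (by positivity) hm hreal
  rw [hMof, ENNReal.ofReal_rpow_of_nonneg hK.le (by positivity),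
    ENNReal.ofReal_rpow_of_nonneg hM0 he.le, ← ENNReal.ofReal_mul (by positivity),
    ← ENNReal.ofReal_mul (by positivity), Real.enorm_eq_ofReal_abs]
  refine ENNReal.ofReal_le_ofReal ?_
  rw [Real.mul_rpow hK.le hVpos.le, Real.mul_rpow (by positivity) hM0] at hfin
  rw [← le_div_iff₀ hVpos] at hfin
  refine hfin.trans (le_of_eq ?_)
  ring

/-- The maximal function is bounded on Morrey spaces. -/
theorem exists_setLIntegral_dyadicMaximal_rpow_le [Nontrivial E] {p m : ℝ} (hp : 1 < p)
    (hm : 0 < m) :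
    ∃ C : ℝ≥0∞, C ≠ ⊤ ∧ ∀ f : E → ℝ≥0∞, Measurable f → ∀ L : ℝ≥0∞, L ≠ ⊤ → (∀ x, f x ≤ L) →
      ∀ K : ℝ, 0 < K → (∀ x r, 0 < r → ∫⁻ y in ball x r, f y ^ p ∂ν ≤
        ENNReal.ofReal (K * r ^ (-m)) ^ p * ν (ball x r)) →
      ∀ x r, 0 < r → ∫⁻ y in ball x r, dyadicMaximal ν f y ^ p ∂ν ≤
        C * (ENNReal.ofReal (K * r ^ (-m)) ^ p * ν (ball x r)) := by
  obtain ⟨C, hC, hmax⟩ := exists_lintegral_dyadicMaximal_rpow_le ν hp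
  have hp0 : 0 < p := by linarith
  have hVt : ν (ball (0 : E) 1) ≠ ⊤ := measure_ball_lt_top.ne
  refine ⟨2 ^ (p - 1) * (C * 2 ^ finrank ℝ E + ν (ball 0 1) ^ p), ?_, ?_⟩
  · have h1 : (2 : ℝ≥0∞) ^ (p - 1) ≠ ⊤ := ENNReal.rpow_ne_top_of_nonneg (by linarith) (by simp)
    have h2 : ν (ball (0 : E) 1) ^ p ≠ ⊤ := ENNReal.rpow_ne_top_of_nonneg hp0.le hVt
    finiteness
  intro f hf L hL hfL K hK hMor x r hr
  have hanti : ∀ t, r ≤ t → ENNReal.ofReal (K * t ^ (-m)) ≤ ENNReal.ofReal (K * r ^ (-m)) := by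
    intro t ht
    refine ENNReal.ofReal_le_ofReal (mul_le_mul_of_nonneg_left ?_ hK.le)
    exact Real.rpow_le_rpow_of_nonpos hr ht (by linarith)
  set c := ENNReal.ofReal (K * r ^ (-m)) with hc
  set g := (ball x (2 * r)).indicator f with hg
  have hgm : Measurable g := hf.indicator measurableSet_ball
  have hgL : ∀ y, g y ≤ L := fun y => (indicator_le_self _ f y).trans (hfL y)
  have hpt : ∀ y ∈ ball x r, dyadicMaximal ν f y ^ p ≤
      2 ^ (p - 1) * (dyadicMaximal ν g y ^ p + (c * ν (ball 0 1)) ^ p) := by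
    intro y hy
    refine (ENNReal.rpow_le_rpow (dyadicMaximal_le_add_of_mem_ball ν hy fun t ht => ?_)
      hp0.le).trans (ENNReal.rpow_add_le_mul_rpow_add_rpow _ _ hp.le)
    refine (ballAvg_le_of_lintegral_rpow_le ν hp hf (hr.trans ht)
      (hMor y t (hr.trans ht))).trans ?_
    gcongr
    exact hanti t ht.le
  have hgint : ∫⁻ y, g y ^ p ∂ν ≤ c ^ p * (2 ^ finrank ℝ E * ν (ball x r)) := by
    calc ∫⁻ y, g y ^ p ∂ν = ∫⁻ y in ball x (2 * r), f y ^ p ∂ν := by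
          rw [← lintegral_indicator measurableSet_ball]
          congr 1 with y
          by_cases hy : y ∈ ball x (2 * r)
          · rw [hg, indicator_of_mem hy, indicator_of_mem hy]
          · rw [hg, indicator_of_notMem hy, indicator_of_notMem hy, ENNReal.zero_rpow_of_pos hp0]
      _ ≤ ENNReal.ofReal (K * (2 * r) ^ (-m)) ^ p * ν (ball x (2 * r)) :=
          hMor x (2 * r) (by positivity)
      _ ≤ c ^ p * (2 ^ finrank ℝ E * ν (ball x r)) := by
          gcongr
          · exact hanti _ (by linarith)
          · rw [Measure.addHaar_ball_mul_of_pos ν x two_pos, ENNReal.ofReal_pow zero_le_two,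
              Measure.addHaar_ball_center ν x]
            simp
  calc ∫⁻ y in ball x r, dyadicMaximal ν f y ^ p ∂ν
      ≤ ∫⁻ y in ball x r,
          2 ^ (p - 1) * (dyadicMaximal ν g y ^ p + (c * ν (ball 0 1)) ^ p) ∂ν :=
        setLIntegral_mono' measurableSet_ball hpt
    _ = 2 ^ (p - 1) * (∫⁻ y in ball x r, dyadicMaximal ν g y ^ p ∂ν +
          (c * ν (ball 0 1)) ^ p * ν (ball x r)) := by
        rw [lintegral_const_mul' _ _ (ENNReal.rpow_ne_top_of_nonneg (by linarith) (by simp)),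
          lintegral_add_right _ measurable_const]
        simp
    _ ≤ 2 ^ (p - 1) * (C * (c ^ p * (2 ^ finrank ℝ E * ν (ball x r))) +
          c ^ p * ν (ball 0 1) ^ p * ν (ball x r)) := by
        rw [ENNReal.mul_rpow_of_nonneg _ _ hp0.le]
        have := ((setLIntegral_le_lintegral (ball x r) _).trans
          (hmax g hgm L hL hgL)).trans (mul_le_mul' le_rfl hgint)
        exact mul_le_mul' le_rfl (add_le_add this le_rfl)
    _ = _ := by ring

theorem exists_setLIntegral_enorm_rpow_le [Nontrivial E] {p m : ℝ} (hp : 1 < p) (hm : 1 < m) :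
    ∃ C : ℝ≥0∞, C ≠ ⊤ ∧ ∀ u : E → ℝ, ContDiff ℝ 1 u → HasCompactSupport u → ∀ K : ℝ, 0 < K →
      (∀ x r, 0 < r → ∫⁻ y in ball x r, ‖fderiv ℝ u y‖ₑ ^ p ∂ν ≤
        ENNReal.ofReal (K * r ^ (-m)) ^ p * ν (ball x r)) →
      ∀ x r, 0 < r → ∫⁻ y in ball x r, ‖u y‖ₑ ^ (m * p / (m - 1)) ∂ν ≤
        C * ENNReal.ofReal (K ^ (m * p / (m - 1)) * r ^ (-(m * p))) * ν (ball x r) := by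
  have hm0 : 0 < m := by linarith
  have hm1 : 0 < m - 1 := by linarith
  have hp0 : 0 < p := by linarith
  obtain ⟨C₁, hC₁, hpt⟩ := exists_enorm_le_dyadicMaximal_rpow ν hm
  obtain ⟨C₂, hC₂, hmax⟩ := exists_setLIntegral_dyadicMaximal_rpow_le ν hp hm0
  set q := m * p / (m - 1) with hq
  have hq0 : 0 < q := by positivity
  have hCq : C₁ ^ q ≠ ⊤ := ENNReal.rpow_ne_top_of_nonneg hq0.le hC₁
  refine ⟨C₁ ^ q * C₂, by finiteness, ?_⟩
  intro u hu hc K hK hMor x r hr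
  set f : E → ℝ≥0∞ := fun y => ‖fderiv ℝ u y‖ₑ with hf
  have hcont : Continuous (fderiv ℝ u) := hu.continuous_fderiv one_ne_zero
  have hfm : Measurable f := hcont.enorm.measurable
  obtain ⟨L, hL⟩ := hcont.bounded_above_of_compact_support (hc.fderiv ℝ)
  have hfL : ∀ y, f y ≤ ENNReal.ofReal L := fun y => by
    rw [hf]; dsimp only; rw [← ofReal_norm]; exact ENNReal.ofReal_le_ofReal (hL y)
  have hMt : ∀ y, dyadicMaximal ν f y ≠ ⊤ := fun y =>
    ne_top_of_le_ne_top (mul_ne_top ofReal_ne_top measure_ball_lt_top.ne)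
      (dyadicMaximal_le_of_le ν hfL y)
  have hpow : ∀ y, ‖u y‖ₑ ^ q ≤
      C₁ ^ q * ENNReal.ofReal (K ^ (q / m)) * dyadicMaximal ν f y ^ p := by
    intro y
    refine (ENNReal.rpow_le_rpow (hpt u hu hc K hK y (fun t ht =>
      ballAvg_le_of_lintegral_rpow_le ν hp hfm ht (hMor y t ht)) (hMt y)) hq0.le).trans
      (le_of_eq ?_)
    rw [ENNReal.mul_rpow_of_nonneg _ _ hq0.le, ENNReal.mul_rpow_of_nonneg _ _ hq0.le,
      ← ENNReal.rpow_mul, ← ENNReal.rpow_mul, ENNReal.ofReal_rpow_of_nonneg hK.le (by positivity)]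
    congr 3
    · congr 1; ring
    · rw [hq]; field_simp
  have hKq : ENNReal.ofReal (K ^ (q / m)) * ENNReal.ofReal (K * r ^ (-m)) ^ p =
      ENNReal.ofReal (K ^ q * r ^ (-(m * p))) := by
    rw [ENNReal.ofReal_rpow_of_nonneg (by positivity) hp0.le, ← ENNReal.ofReal_mul (by positivity),
      Real.mul_rpow hK.le (by positivity), ← Real.rpow_mul hr.le, ← mul_assoc,
      ← Real.rpow_add hK]
    congr 3
    · rw [hq]; field_simp; ring
    · ring
  have hcoef : C₁ ^ q * ENNReal.ofReal (K ^ (q / m)) ≠ ⊤ := mul_ne_top hCq ofReal_ne_top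
  calc ∫⁻ y in ball x r, ‖u y‖ₑ ^ q ∂ν
      ≤ ∫⁻ y in ball x r, C₁ ^ q * ENNReal.ofReal (K ^ (q / m)) * dyadicMaximal ν f y ^ p ∂ν :=
        lintegral_mono hpow
    _ = C₁ ^ q * ENNReal.ofReal (K ^ (q / m)) *
          ∫⁻ y in ball x r, dyadicMaximal ν f y ^ p ∂ν := lintegral_const_mul' _ _ hcoef
    _ ≤ C₁ ^ q * ENNReal.ofReal (K ^ (q / m)) *
          (C₂ * (ENNReal.ofReal (K * r ^ (-m)) ^ p * ν (ball x r))) :=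
        mul_le_mul' le_rfl (hmax f hfm _ ofReal_ne_top hfL K hK hMor x r hr)
    _ = C₁ ^ q * C₂ * (ENNReal.ofReal (K ^ (q / m)) * ENNReal.ofReal (K * r ^ (-m)) ^ p) *
          ν (ball x r) := by ring
    _ = _ := by rw [hKq]

end MaximalFunction

theorem ofReal_setIntegral_ball_abs_rpow {d : ℕ} {p : ℝ} (hp : 0 < p)
    {g : EuclideanSpace ℝ (Fin d) → ℝ} (hg : Continuous g) (x : EuclideanSpace ℝ (Fin d))
    (r : ℝ) :
    ENNReal.ofReal (∫ y in ball x r, |g y| ^ p) = ∫⁻ y in ball x r, ‖g y‖ₑ ^ p := by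
  have hcont : Continuous fun y => |g y| ^ p := hg.abs.rpow_const fun _ => Or.inr hp.le
  have hint : IntegrableOn (fun y => |g y| ^ p) (ball x r) :=
    (hcont.continuousOn.integrableOn_compact (isCompact_closedBall x r)).mono_set
      ball_subset_closedBall
  rw [ofReal_integral_eq_lintegral_ofReal hint (Filter.Eventually.of_forall fun y => by positivity)]
  congr 1 with y
  rw [Real.enorm_eq_ofReal_abs, ENNReal.ofReal_rpow_of_nonneg (abs_nonneg _) hp.le]

theorem morreyNormFull_le_ofReal_iff {d : ℕ} {p m K : ℝ} (hp : 0 < p) (hK : 0 < K)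
    {g : EuclideanSpace ℝ (Fin d) → ℝ} (hg : Continuous g) :
    morreyNormFull d p m g ≤ ENNReal.ofReal K ↔ ∀ x r, 0 < r →
      ∫⁻ y in ball x r, ‖g y‖ₑ ^ p ≤
        ENNReal.ofReal (K * r ^ (-m)) ^ p * volume (ball x r) := by
  simp only [morreyNormFull, iSup_le_iff]
  refine forall_congr' fun x => forall_congr' fun r => forall_congr' fun hr => ?_
  have hBt : volume (ball x r) ≠ ⊤ := measure_ball_lt_top.ne
  have hB : 0 < (volume (ball x r)).toReal :=
    ENNReal.toReal_pos (measure_ball_pos volume x hr).ne' hBt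
  have hI : 0 ≤ ∫ y in ball x r, |g y| ^ p := integral_nonneg fun y => by positivity
  rw [ENNReal.ofReal_le_ofReal_iff hK.le, ← ofReal_setIntegral_ball_abs_rpow hp hg,
    ← ENNReal.ofReal_toReal hBt, ENNReal.ofReal_rpow_of_nonneg (by positivity) hp.le,
    ← ENNReal.ofReal_mul (by positivity), ENNReal.ofReal_le_ofReal_iff (by positivity),
    ENNReal.toReal_ofReal hB.le, ← le_div_iff₀' (by positivity), one_div,
    Real.rpow_inv_le_iff_of_pos (by positivity) (by positivity) hp, inv_mul_le_iff₀ hB,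
    Real.rpow_neg hr.le, div_eq_mul_inv, mul_comm ((volume (ball x r)).toReal)]

/-- Theorem 2.1 of the paper: for `1 < μ ≤ d/p`, `p > 1` and
`1/q = 1/p - 1/(μp)`, one has `‖u‖_{E_{q,μp/q}} ≤ N(d,p,μ) ‖Du‖_{E_{p,μ}}`. -/
theorem morrey_embedding (d : ℕ) (hd : 2 ≤ d) (p μ q : ℝ)
    (hp : 1 < p) (hμ1 : 1 < μ) (hμ2 : μ ≤ d / p)
    (hq : 1 / q = 1 / p - 1 / (μ * p)) :
    ∃ N : ℝ, 0 < N ∧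
      ∀ u : EuclideanSpace ℝ (Fin d) → ℝ, ContDiff ℝ 1 u → HasCompactSupport u →
        morreyNormFull d q (μ * p / q) u ≤
          ENNReal.ofReal N *
            morreyNormFull d p μ (fun y => ‖gradient u y‖) := by
  have hp0 : 0 < p := by linarith
  have hμ0 : 0 < μ := by linarith
  have hμ' : 0 < μ - 1 := by linarith
  have hqeq : q = μ * p / (μ - 1) := by
    rw [← one_div_one_div q, hq]
    field_simp
  have hq0 : 0 < q := by rw [hqeq]; positivity
  have : NeZero d := ⟨by omega⟩
  obtain ⟨C, hC, hbound⟩ := exists_setLIntegral_enorm_rpow_le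
    (volume : Measure (EuclideanSpace ℝ (Fin d))) hp hμ1
  rw [← hqeq] at hbound
  set N : ℝ := C.toReal ^ (1 / q) + 1 with hN
  have hNpos : 0 < N := by positivity
  have hCN : C ≤ ENNReal.ofReal (N ^ q) := by
    rw [← ENNReal.ofReal_toReal hC]
    refine ENNReal.ofReal_le_ofReal ?_
    calc C.toReal = (C.toReal ^ (1 / q)) ^ q := by
          rw [← Real.rpow_mul ENNReal.toReal_nonneg, one_div_mul_cancel hq0.ne', Real.rpow_one]
      _ ≤ N ^ q := Real.rpow_le_rpow (by positivity) (by linarith) hq0.le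
  refine ⟨N, hNpos, fun u hu hc => ?_⟩
  have hnorm : ∀ y, ‖gradient u y‖ = ‖fderiv ℝ u y‖ := fun y => by
    rw [← toDual_gradient, LinearIsometryEquiv.norm_map]
  have hgrad : Continuous fun y => ‖gradient u y‖ := by
    simp_rw [hnorm]
    exact (hu.continuous_fderiv one_ne_zero).norm
  have hstep : ∀ K : ℝ, 0 < K → morreyNormFull d p μ (fun y => ‖gradient u y‖) ≤
      ENNReal.ofReal K → morreyNormFull d q (μ * p / q) u ≤ ENNReal.ofReal (N * K) := by
    intro K hK hle
    rw [morreyNormFull_le_ofReal_iff hp0 hK hgrad] at hle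
    rw [morreyNormFull_le_ofReal_iff hq0 (by positivity) hu.continuous]
    intro x r hr
    simp_rw [hnorm, enorm_norm] at hle
    refine (hbound u hu hc K hK hle x r hr).trans (mul_le_mul' ?_ le_rfl)
    refine (mul_le_mul' hCN le_rfl).trans (le_of_eq ?_)
    rw [← ENNReal.ofReal_mul (by positivity), ENNReal.ofReal_rpow_of_nonneg (by positivity) hq0.le,
      Real.mul_rpow (by positivity) (by positivity), Real.mul_rpow hNpos.le hK.le,
      ← Real.rpow_mul hr.le, neg_mul, div_mul_cancel₀ _ hq0.ne', mul_assoc]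
  rcases eq_or_ne (morreyNormFull d p μ (fun y => ‖gradient u y‖)) ⊤ with htop | htop
  · rw [htop, ENNReal.mul_top (by simpa using hNpos)]
    exact le_top
  refine ENNReal.le_of_forall_pos_le_add fun ε hε _ => ?_
  set S := (morreyNormFull d p μ (fun y => ‖gradient u y‖)).toReal with hS
  have hS0 : 0 ≤ S := ENNReal.toReal_nonneg
  have hεpos : 0 < (ε : ℝ) / N := div_pos hε hNpos
  rw [← ENNReal.ofReal_toReal htop]
  refine (hstep (S + ε / N) (by positivity) ?_).trans (le_of_eq ?_)
  · rw [← ENNReal.ofReal_toReal htop]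
    exact ENNReal.ofReal_le_ofReal (by linarith)
  · rw [mul_add, mul_div_cancel₀ _ hNpos.ne', ENNReal.ofReal_add (by positivity) ε.coe_nonneg,
      ENNReal.ofReal_mul hNpos.le, ENNReal.ofReal_coe_nnreal]
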